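/- arXiv:1802.08676 — 3 statements merged into one kernel-verified Lean document; each statement's English description precedes it below -/
import Mathlib

section
/- Let f_1,…,f_K be additive utility functions with strictly positive link costs. Let x = [SN, r_1, …, r_m, DN] be a route from the source node SN to the destination node DN, let x' = [SN, r_1, …, r_m] be its sub-route obtained by deleting the final hop, and let S be a set of routes from SN to DN. If there exists a route x_d ∈ S that weakly dominates the sub-route, i.e. f(x_d) ≽ f(x'), then for every node R_j the generated route x_g = [SN, r_1, …, r_m, R_j, DN] (obtained by inserting the single relay R_j between the last relay and the DN) is strongly dominated by x_d, i.e. f_k(x_d) < f_k(x_g) for all k = 1,…,K; consequently x_g is not Pareto-optimal in S. -/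
/-- Additive route cost: the sum of the positive link costs over the
consecutive pairs (links) of the route. -/
def routeCost {V : Type*} (w : V → V → ℝ) (x : List V) : ℝ :=
  ((x.zip x.tail).map fun p => w p.1 p.2).sum

/-- Strong Pareto dominance of utility vectors: `u ≻ v`. -/
def StrongDom {K : ℕ} (u v : Fin K → ℝ) : Prop :=
  ∀ k, u k < v k

/-- Weak Pareto dominance of utility vectors: `u ≽ v`. -/
def WeakDom {K : ℕ} (u v : Fin K → ℝ) : Prop :=
  (∀ k, u k ≤ v k) ∧ ∃ k, u k < v k

/-- A route `x` is Pareto-optimal in a set `S` of routes if no route of `S`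
strongly dominates it. -/
def ParetoOptimalIn {V : Type*} {K : ℕ}
    (f : List V → Fin K → ℝ) (S : Set (List V)) (x : List V) : Prop :=
  ∀ y ∈ S, ¬ StrongDom (f y) (f x)

theorem routeCost_lt_append {V : Type*} (w : V → V → ℝ) (hw : ∀ u v, 0 < w u v)
    (a b : V) (rs : List V) : ∀ s : V,
    routeCost w (s :: rs) < routeCost w (s :: (rs ++ [a, b])) := by
  induction rs with
  | nil =>
    intro s
    have h1 := hw s a
    have h2 := hw a b
    simp [routeCost]
    linarith
  | cons r rs ih =>
    intro s
    have h := ih r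
    simp [routeCost] at h ⊢
    exact h

theorem stmt0 {V : Type*} {K : ℕ} (w : Fin K → V → V → ℝ)
    (hw : ∀ k u v, 0 < w k u v)
    (SN DN : V) (rs : List V) (S : Set (List V))
    (xd : List V) (hxdS : xd ∈ S)
    (hweak : WeakDom (fun k => routeCost (w k) xd)
      (fun k => routeCost (w k) (SN :: rs))) :
    ∀ Rj : V,
      StrongDom (fun k => routeCost (w k) xd)
        (fun k => routeCost (w k) (SN :: (rs ++ [Rj, DN]))) ∧
      ¬ ParetoOptimalIn (fun x k => routeCost (w k) x) S
        (SN :: (rs ++ [Rj, DN])) := by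
  intro Rj
  have h : StrongDom (fun k => routeCost (w k) xd)
      (fun k => routeCost (w k) (SN :: (rs ++ [Rj, DN]))) := fun k =>
    lt_of_le_of_lt (hweak.1 k) (routeCost_lt_append (w k) (hw k) Rj DN rs SN)
  exact ⟨h, fun hp => hp xd hxdS h⟩
end

section
/- If every link bit error ratio satisfies p_i ∈ [0, 1], then the recursively defined end-to-end BER is nonnegative and is upper-bounded by the sum of the link BERs: 0 ≤ BER([p_1,…,p_n]) ≤ Σ_{i=1}^{n} p_i. Hence the sum of the individual link BERs in Eq. (7) over-approximates the exact end-to-end BER of Eq. (4). -/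
/-- End-to-end bit error ratio of a chain of links, obtained by iterating the
two-stage binary-symmetric-channel composition `P(p, q) = p + q − 2·p·q`. -/
def ber : List ℝ → ℝ
  | [] => 0
  | p :: L => p + ber L - 2 * p * ber L

theorem ber_bounds (L : List ℝ) (h : ∀ p ∈ L, 0 ≤ p ∧ p ≤ 1) :
    0 ≤ ber L ∧ ber L ≤ 1 ∧ ber L ≤ L.sum := by
  induction L with
  | nil => simp [ber]
  | cons p L ih =>
    obtain ⟨h0, h1, h2⟩ := ih (fun q hq => h q (List.mem_cons_of_mem _ hq))
    obtain ⟨p0, p1⟩ := h p List.mem_cons_self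
    have a := mul_nonneg p0 h0
    have b := mul_nonneg p0 (sub_nonneg.2 h1)
    have c := mul_nonneg (sub_nonneg.2 p1) h0
    have d := mul_nonneg (sub_nonneg.2 p1) (sub_nonneg.2 h1)
    simp only [ber, List.sum_cons]
    refine ⟨?_, ?_, ?_⟩ <;> nlinarith

/-- If every link BER lies in `[0, 1]`, then the end-to-end BER is nonnegative
and upper-bounded by the sum of the link BERs. -/
theorem stmt7 (L : List ℝ) (h : ∀ p ∈ L, 0 ≤ p ∧ p ≤ 1) :
    0 ≤ ber L ∧ ber L ≤ L.sum := by
  exact ⟨(ber_bounds L h).1, (ber_bounds L h).2.2⟩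
end

section
/- If every link bit error ratio satisfies p_i ∈ [0, 1/2], then the approximation error ε = Σ_{i=1}^{n} p_i − BER([p_1,…,p_n]) of Eq. (7) is bounded by a sum of pairwise products of link BERs: 0 ≤ Σ_{i=1}^{n} p_i − BER([p_1,…,p_n]) ≤ 2 · Σ_{1 ≤ i < j ≤ n} p_i p_j. -/
theorem ber_nonneg_le (L : List ℝ) (h : ∀ p ∈ L, 0 ≤ p ∧ p ≤ 1 / 2) :
    0 ≤ ber L ∧ ber L ≤ 1 / 2 := by
  induction L with
  | nil => norm_num [ber]
  | cons p L ih =>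
    obtain ⟨h0, h1⟩ := ih (fun q hq => h q (List.mem_cons_of_mem _ hq))
    obtain ⟨p0, p1⟩ := h p List.mem_cons_self
    simp only [ber]
    constructor <;> nlinarith

theorem sum_eq_getD (L : List ℝ) :
    ∑ j ∈ Finset.range L.length, L.getD j 0 = L.sum := by
  induction L with
  | nil => simp
  | cons p L ih =>
    rw [List.length_cons, Finset.sum_range_succ', List.sum_cons, ← ih]
    simp [add_comm]

theorem pair_cons (p : ℝ) (L : List ℝ) :
    ∑ i ∈ Finset.range (p :: L).length, ∑ j ∈ Finset.Ioo i (p :: L).length,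
        (p :: L).getD i 0 * (p :: L).getD j 0 =
    (∑ i ∈ Finset.range L.length, ∑ j ∈ Finset.Ioo i L.length,
        L.getD i 0 * L.getD j 0) + p * L.sum := by
  have key : ∀ (i n : ℕ) (f : ℕ → ℝ),
      ∑ j ∈ Finset.Ioo (i + 1) (n + 1), f j = ∑ j ∈ Finset.Ioo i n, f (j + 1) := by
    intro i n f
    rw [← Finset.map_add_right_Ioo, Finset.sum_map]
    rfl
  have key0 : ∀ (n : ℕ) (f : ℕ → ℝ),
      ∑ j ∈ Finset.Ioo 0 (n + 1), f j = ∑ j ∈ Finset.range n, f (j + 1) := by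
    intro n f
    have : Finset.Ioo 0 (n + 1) = Finset.Ico (0 + 1) (n + 1) := by
      ext x; simp only [Finset.mem_Ioo, Finset.mem_Ico]; omega
    rw [this, ← Finset.map_add_right_Ico, Finset.sum_map, Finset.range_eq_Ico]
    rfl
  rw [List.length_cons, Finset.sum_range_succ', key0, ← sum_eq_getD L, Finset.mul_sum]
  simp only [key, List.getD_cons_succ, List.getD_cons_zero]

/-- If every link BER lies in `[0, 1/2]`, then the error of approximating the
end-to-end BER by the sum of the link BERs is nonnegative and bounded by
twice the sum of the pairwise products of the link BERs:
`0 ≤ Σ_i p_i − BER([p_1,…,p_n]) ≤ 2 · Σ_{i < j} p_i · p_j`. -/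
theorem stmt8 (L : List ℝ) (h : ∀ p ∈ L, 0 ≤ p ∧ p ≤ 1 / 2) :
    0 ≤ L.sum - ber L ∧
    L.sum - ber L ≤
      2 * ∑ i ∈ Finset.range L.length, ∑ j ∈ Finset.Ioo i L.length,
        L.getD i 0 * L.getD j 0 := by
  induction L with
  | nil => simp [ber]
  | cons p L ih =>
    have hL : ∀ q ∈ L, 0 ≤ q ∧ q ≤ 1 / 2 := fun q hq => h q (List.mem_cons_of_mem _ hq)
    obtain ⟨h0, h1⟩ := ih hL
    obtain ⟨b0, b1⟩ := ber_nonneg_le L hL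
    obtain ⟨p0, p1⟩ := h p List.mem_cons_self
    rw [pair_cons, List.sum_cons]
    simp only [ber]
    have m1 := mul_nonneg p0 b0
    have m2 := mul_nonneg p0 h0
    constructor <;> nlinarith
end
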